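/- arXiv:math/0702027 — 2 statements merged into one kernel-verified Lean document; each statement's English description precedes it below -/
import Mathlib

section
/- For every positive integer N, all Fourier coefficients of the eta product S_N(τ) = η(Nτ)^{φ(N)} / ∏_{d|N} η(dτ)^{μ(d)} are nonnegative. Equivalently, the formal power series E(q^N)^{φ(N)} / ∏_{d|N} E(q^d)^{μ(d)} has nonnegative coefficients, where E(q) = ∏_{n≥1}(1-q^n). -/
/-- `E(q) = ∏_{n ≥ 1} (1 - qⁿ)`. -/
noncomputable def Eprod (q : ℂ) : ℂ := ∏' n : ℕ, (1 - q ^ (n + 1))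

open Filter Topology Finset

/-- The triangular number `n (n - 1) / 2`, for an integer `n`. -/
def tri (n : ℤ) : ℤ := n * (n - 1) / 2

lemma two_mul_tri (n : ℤ) : 2 * tri n = n * (n - 1) := by
  have h : (2 : ℤ) ∣ n * (n - 1) := by
    simpa [mul_comm] using (Int.even_mul_pred_self n).two_dvd
  exact Int.mul_ediv_cancel' h

lemma tri_add (m n : ℤ) : tri (m + n) = tri m + tri n + m * n := by
  have h1 := two_mul_tri (m + n)
  have h2 := two_mul_tri m
  have h3 := two_mul_tri n
  nlinarith

lemma tri_sub (m n : ℤ) : tri (m - n) = tri m + tri n + n - m * n := by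
  have h1 := two_mul_tri (m - n)
  have h2 := two_mul_tri m
  have h3 := two_mul_tri n
  nlinarith

lemma tri_nonneg (n : ℤ) : 0 ≤ tri n := by
  have h := two_mul_tri n
  rcases le_or_gt n 0 with h0 | h0 <;> nlinarith

@[simp] lemma tri_zero : tri 0 = 0 := rfl

/-- The infinite `q`-Pochhammer symbol `(z; q)_∞`. -/
noncomputable def qPoch (z q : ℂ) : ℂ := ∏' n : ℕ, (1 - z * q ^ n)

lemma Eprod_eq_qPoch (q : ℂ) : Eprod q = qPoch q q := by
  simp only [Eprod, qPoch, pow_succ']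

lemma summable_norm_mul_pow (z : ℂ) {q : ℂ} (hq : ‖q‖ < 1) :
    Summable fun n : ℕ => ‖-(z * q ^ n)‖ := by
  simpa using (summable_geometric_of_lt_one (norm_nonneg q) hq).mul_left ‖z‖

lemma multipliable_qPoch (z : ℂ) {q : ℂ} (hq : ‖q‖ < 1) :
    Multipliable fun n : ℕ => 1 - z * q ^ n := by
  simpa [sub_eq_add_neg] using multipliable_one_add_of_summable (summable_norm_mul_pow z hq)

lemma qPoch_ne_zero {z q : ℂ} (hq : ‖q‖ < 1) (hz : ∀ n : ℕ, 1 - z * q ^ n ≠ 0) :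
    qPoch z q ≠ 0 := by
  have := tprod_one_add_ne_zero_of_summable (f := fun n : ℕ => -(z * q ^ n))
    (by simpa [sub_eq_add_neg] using hz) (summable_norm_mul_pow z hq)
  simpa [qPoch, sub_eq_add_neg] using this

lemma qPoch_ne_zero_of_norm_lt {z q : ℂ} (hq : ‖q‖ < 1) (hz : ‖z‖ < 1) : qPoch z q ≠ 0 := by
  refine qPoch_ne_zero hq fun n h => ?_
  have h1 : ‖z * q ^ n‖ < 1 := by
    rw [norm_mul, norm_pow]
    exact mul_lt_one_of_nonneg_of_lt_one_left (norm_nonneg z) hz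
      (pow_le_one₀ (norm_nonneg q) hq.le)
  rw [← sub_eq_zero.mp h] at h1
  simp at h1

lemma Eprod_ne_zero {q : ℂ} (hq : ‖q‖ < 1) : Eprod q ≠ 0 := by
  rw [Eprod_eq_qPoch]
  exact qPoch_ne_zero_of_norm_lt hq hq

lemma qPoch_eq_mul (z : ℂ) {q : ℂ} (hq : ‖q‖ < 1) :
    qPoch z q = (1 - z) * qPoch (z * q) q := by
  have h := multipliable_qPoch (z * q) hq
  simp only [qPoch, mul_assoc, ← pow_succ'] at h ⊢
  simpa using tprod_eq_zero_mul' (f := fun n : ℕ => 1 - z * q ^ n) h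

lemma tendsto_qPoch (z : ℂ) {q : ℂ} (hq : ‖q‖ < 1) :
    Tendsto (fun N => ∏ i ∈ range N, (1 - z * q ^ i)) atTop (𝓝 (qPoch z q)) :=
  (multipliable_qPoch z hq).hasProd.tendsto_prod_nat

lemma tendsto_Eprod {q : ℂ} (hq : ‖q‖ < 1) :
    Tendsto (fun N => ∏ i ∈ range N, (1 - q ^ (i + 1))) atTop (𝓝 (Eprod q)) := by
  rw [Eprod_eq_qPoch]
  simpa only [pow_succ'] using tendsto_qPoch q hq

lemma continuous_qPoch {q : ℂ} (hq : ‖q‖ < 1) : Continuous fun z => qPoch z q := by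
  refine continuous_iff_continuousAt.mpr fun z => ?_
  have := tendsto_tprod_one_add_of_dominated_convergence (𝓕 := 𝓝 z)
    (f := fun w (n : ℕ) => -(w * q ^ n)) (g := fun n => -(z * q ^ n))
    (bound := fun n => (‖z‖ + 1) * ‖q‖ ^ n)
    ((summable_geometric_of_lt_one (norm_nonneg q) hq).mul_left _)
    (fun n => (Continuous.tendsto (by fun_prop) z)) ?_
  · simpa [ContinuousAt, qPoch, sub_eq_add_neg] using this
  · filter_upwards [Metric.ball_mem_nhds z one_pos] with w hw n
    rw [norm_neg, norm_mul, norm_pow]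
    gcongr
    have h1 := norm_le_norm_add_norm_sub' w z
    rw [Metric.mem_ball, dist_eq_norm] at hw
    linarith

lemma tendsto_Eprod_nhds_zero : Tendsto Eprod (𝓝 0) (𝓝 1) := by
  have := tendsto_tprod_one_add_of_dominated_convergence (𝓕 := 𝓝 (0 : ℂ))
    (f := fun w (n : ℕ) => -(w ^ (n + 1))) (g := fun n => 0)
    (bound := fun n => (1 / 2) ^ (n + 1))
    ((summable_nat_add_iff 1).mpr summable_geometric_two)
    (fun n => by
      have : Continuous fun w : ℂ => -(w ^ (n + 1)) := by fun_prop
      simpa using this.tendsto 0) ?_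
  · simp only [tprod_one, add_zero, ← sub_eq_add_neg] at this
    exact this
  · filter_upwards [Metric.ball_mem_nhds (0 : ℂ) (ε := 1 / 2) (by norm_num)] with w hw n
    rw [norm_neg, norm_pow]
    gcongr
    simpa using (mem_ball_zero_iff.mp hw).le

/-- The two-sided theta series `∑ (-1)ⁿ zⁿ q^{n(n-1)/2}`. -/
noncomputable def theta (z q : ℂ) : ℂ := ∑' n : ℤ, (-1) ^ n * z ^ n * q ^ tri n

lemma summable_real_theta {x r : ℝ} (hx : 0 < x) (hr : 0 < r) (hr1 : r < 1) :
    Summable fun n : ℤ => x ^ n * r ^ tri n := by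
  have key : ∀ (y : ℝ) (c : ℤ), 0 < y →
      Summable fun n : ℕ => y ^ (n : ℤ) * r ^ (tri n + c * n) := by
    intro y c hy
    have hl : Tendsto (fun n : ℕ => y * r ^ c * r ^ n) atTop (𝓝 0) := by
      simpa using (tendsto_pow_atTop_nhds_zero_of_lt_one hr.le hr1).const_mul (y * r ^ c)
    refine summable_of_ratio_test_tendsto_lt_one zero_lt_one
      (Eventually.of_forall fun n => by positivity) (hl.congr fun n => ?_)
    rw [Real.norm_of_nonneg (by positivity), Real.norm_of_nonneg (by positivity)]
    have h1 : tri ((n + 1 : ℕ) : ℤ) + c * ((n + 1 : ℕ) : ℤ) = tri n + c * n + (n + c) := by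
      push_cast
      rw [tri_add]
      simp [tri]
      ring
    rw [h1, zpow_add₀ hr.ne', zpow_add₀ hr.ne', Nat.cast_succ, zpow_add₀ hy.ne', zpow_one]
    rw [← zpow_natCast r n, zpow_add₀ hr.ne' n c]
    field_simp
  refine Summable.of_nat_of_neg (by simpa using key x 0 hx) ?_
  refine (key x⁻¹ 1 (by positivity)).congr fun n => ?_
  have h2 : tri (-(n : ℤ)) = tri n + 1 * n := by
    have h1 := two_mul_tri (-(n : ℤ))
    have h3 := two_mul_tri n
    nlinarith
  rw [h2, inv_zpow', zpow_neg]

lemma summable_norm_theta {z q : ℂ} (hz : z ≠ 0) (hq0 : q ≠ 0) (hq : ‖q‖ < 1) :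
    Summable fun n : ℤ => ‖(-1) ^ n * z ^ n * q ^ tri n‖ := by
  simpa using summable_real_theta (norm_pos_iff.mpr hz) (norm_pos_iff.mpr hq0) hq

/-- The reciprocal of the finite product `(q; q)_n`, extended by zero to negative `n`. -/
noncomputable def invPoch (q : ℂ) (n : ℤ) : ℂ :=
  if n < 0 then 0 else (∏ i ∈ range n.toNat, (1 - q ^ (i + 1)))⁻¹

lemma one_sub_pow_ne_zero {q : ℂ} (hq : ‖q‖ < 1) (n : ℕ) : 1 - q ^ (n + 1) ≠ 0 := by
  intro h
  have h1 : ‖q ^ (n + 1)‖ < 1 := by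
    rw [norm_pow]
    exact pow_lt_one₀ (norm_nonneg q) hq n.succ_ne_zero
  rw [← sub_eq_zero.mp h] at h1
  simp at h1

lemma invPoch_pred {q : ℂ} (hq : ‖q‖ < 1) {m n : ℤ} (h : n = m - 1) :
    invPoch q n = (1 - q ^ m) * invPoch q m := by
  subst h
  rcases lt_trichotomy m 0 with hm | rfl | hm
  · simp [invPoch, hm, show m < 1 by omega]
  · simp [invPoch]
  · obtain ⟨k, rfl⟩ : ∃ k : ℕ, m = k + 1 := ⟨(m - 1).toNat, by omega⟩
    have h1 : ¬ ((k : ℤ) + 1 < 0) := by omega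
    have h2 : ((k : ℤ) + 1).toNat = k + 1 := by omega
    have h3 := one_sub_pow_ne_zero hq k
    simp only [invPoch, add_sub_cancel_right, h1, if_false, h2, prod_range_succ]
    norm_cast
    simp only [Nat.not_lt_zero, if_false]
    field_simp

lemma hasSum_finite_triple_product {z q : ℂ} (hz : z ≠ 0) (hq0 : q ≠ 0) (hq : ‖q‖ < 1) (N : ℕ) :
    HasSum (fun k : ℤ => (∏ i ∈ range (2 * N), (1 - q ^ (i + 1))) *
        (invPoch q (N + k) * invPoch q (N - k)) * ((-1) ^ k * z ^ k * q ^ tri k))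
      ((∏ i ∈ range N, (1 - z * q ^ i)) * ∏ i ∈ range N, (1 - q / z * q ^ i)) := by
  induction N with
  | zero =>
    convert hasSum_single (0 : ℤ) ?_ using 1
    · simp [invPoch]
    · intro k hk
      rcases hk.lt_or_gt with h | h <;> simp [invPoch, h]
  | succ N ih =>
    set p := (∏ i ∈ range N, (1 - z * q ^ i)) * ∏ i ∈ range N, (1 - q / z * q ^ i) with hp
    have h1 := ((Equiv.subRight (1 : ℤ)).hasSum_iff.mpr ih).mul_left (-(z * q ^ N))
    have h2 := ((Equiv.addRight (1 : ℤ)).hasSum_iff.mpr ih).mul_left (-(q ^ (N + 1) / z))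
    have h3 := ((ih.mul_left (1 + q ^ (2 * N + 1))).add h1).add h2
    have h4 : (∏ i ∈ range (N + 1), (1 - z * q ^ i)) * ∏ i ∈ range (N + 1), (1 - q / z * q ^ i) =
        (1 + q ^ (2 * N + 1)) * p + -(z * q ^ N) * p + -(q ^ (N + 1) / z) * p := by
      rw [prod_range_succ, prod_range_succ, hp]
      field_simp
      ring
    rw [h4]
    refine (congrArg (HasSum · _) (funext fun k => ?_)).mpr h3
    simp only [Function.comp_apply, Equiv.subRight_apply, Equiv.coe_addRight]
    have hN : 2 * (N + 1) = 2 * N + 1 + 1 := by ring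
    have t1 : tri (k - 1) = tri k - k + 1 := by
      have h1 := two_mul_tri (k - 1)
      have h2 := two_mul_tri k
      nlinarith
    have t2 : tri (k + 1) = tri k + k := by
      have h1 := two_mul_tri (k + 1)
      have h2 := two_mul_tri k
      nlinarith
    have a1 := invPoch_pred hq (show (N : ℤ) + k = (N + 1 + k) - 1 by ring)
    have a2 := invPoch_pred hq (show (N : ℤ) - k = (N + 1 - k) - 1 by ring)
    have a3 := invPoch_pred hq (show (N : ℤ) + (k - 1) = (N + k) - 1 by ring)
    have a4 := invPoch_pred hq (show (N : ℤ) - (k + 1) = (N - k) - 1 by ring)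
    have a5 : (N : ℤ) - (k - 1) = N + 1 - k := by ring
    have a6 : (N : ℤ) + (k + 1) = N + 1 + k := by ring
    rw [hN, prod_range_succ _ (2 * N + 1), prod_range_succ _ (2 * N), a3, a4, a5, a6, a1, a2,
      t1, t2]
    push_cast
    generalize invPoch q (N + 1 + k) = A
    generalize invPoch q (N + 1 - k) = B
    generalize ∏ i ∈ range (2 * N), (1 - q ^ (i + 1)) = C
    simp only [zpow_add₀ hq0, zpow_sub₀ hq0, zpow_add₀ hz, zpow_sub₀ hz, zpow_natCast,
      zpow_one, zpow_add₀ (show (-1 : ℂ) ≠ 0 by norm_num),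
      zpow_sub₀ (show (-1 : ℂ) ≠ 0 by norm_num)]
    have hx : q ^ k ≠ 0 := zpow_ne_zero _ hq0
    generalize q ^ k = x at hx
    generalize q ^ tri k = y
    generalize z ^ k = w
    generalize (-1 : ℂ) ^ k = e
    field_simp
    ring

/-- The Jacobi triple product identity. -/
theorem theta_eq_qPoch {z q : ℂ} (hz : z ≠ 0) (hq0 : q ≠ 0) (hq : ‖q‖ < 1) :
    theta z q = Eprod q * (qPoch z q * qPoch (q / z) q) := by
  have hE := tendsto_Eprod hq
  have hE0 := Eprod_ne_zero hq
  set p : ℕ → ℂ := fun N => ∏ i ∈ range N, (1 - q ^ (i + 1)) with hp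
  have hinv : ∀ n : ℕ, invPoch q n = (p n)⁻¹ := fun n => by
    simp [invPoch, hp]
  have hinvlim : Tendsto (invPoch q) atTop (𝓝 (Eprod q)⁻¹) := by
    have h1 : Tendsto (fun n : ℤ => (p n.toNat)⁻¹) atTop (𝓝 (Eprod q)⁻¹) :=
      (hE.inv₀ hE0).comp (tendsto_atTop_atTop.mpr fun b => ⟨b, fun a ha => by omega⟩)
    refine h1.congr' ?_
    filter_upwards [eventually_ge_atTop 0] with n hn
    simp [invPoch, hp, not_lt.mpr hn]
  obtain ⟨A, hA⟩ := hE.norm.bddAbove_range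
  obtain ⟨B, hB⟩ := (hE.inv₀ hE0).norm.bddAbove_range
  have hA' : ∀ n, ‖p n‖ ≤ A := fun n => hA ⟨n, rfl⟩
  have hB0 : 0 ≤ B := (norm_nonneg _).trans (hB ⟨0, rfl⟩)
  have hB' : ∀ n, ‖invPoch q n‖ ≤ B := by
    intro n
    rcases lt_or_ge n 0 with h | h
    · simpa [invPoch, h] using hB0
    · lift n to ℕ using h
      rw [hinv]
      exact hB ⟨n, rfl⟩
  have hlim := tendsto_tsum_of_dominated_convergence (𝓕 := atTop)
    (f := fun (N : ℕ) (k : ℤ) => p (2 * N) * (invPoch q (N + k) * invPoch q (N - k)) *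
      ((-1) ^ k * z ^ k * q ^ tri k))
    (g := fun k => Eprod q * ((Eprod q)⁻¹ * (Eprod q)⁻¹) * ((-1) ^ k * z ^ k * q ^ tri k))
    (bound := fun k => A * (B * B) * ‖(-1) ^ k * z ^ k * q ^ tri k‖)
    ((summable_norm_theta hz hq0 hq).mul_left _) ?_ ?_
  · have h1 := tendsto_nhds_unique
      (hlim.congr fun N => (hasSum_finite_triple_product hz hq0 hq N).tsum_eq)
      ((tendsto_qPoch z hq).mul (tendsto_qPoch (q / z) hq))
    rw [tsum_mul_left] at h1
    rw [← h1, theta]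
    field_simp
  · intro k
    have hN : Tendsto (fun N : ℕ => 2 * N) atTop atTop :=
      tendsto_atTop_mono (fun n => by simp only [id]; omega) tendsto_id
    have h1 : Tendsto (fun N : ℕ => (N : ℤ) + k) atTop atTop :=
      tendsto_atTop_add_const_right _ _ tendsto_natCast_atTop_atTop
    have h2 : Tendsto (fun N : ℕ => (N : ℤ) - k) atTop atTop :=
      tendsto_atTop_add_const_right _ (-k) tendsto_natCast_atTop_atTop
    exact ((hE.comp hN).mul ((hinvlim.comp h1).mul (hinvlim.comp h2))).mul_const _
  · refine Eventually.of_forall fun N k => ?_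
    rw [norm_mul, norm_mul, norm_mul]
    gcongr
    · exact (norm_nonneg _).trans (hA' 0)
    · exact hA' _
    · exact hB' _
    · exact hB' _

lemma hasSum_mul_pow {a b : ℕ → ℝ} {q A B : ℂ}
    (h1 : HasSum (fun n => (a n : ℂ) * q ^ n) A) (h2 : HasSum (fun n => (b n : ℂ) * q ^ n) B) :
    HasSum (fun i : ℕ × ℕ => ((a i.1 * b i.2 : ℝ) : ℂ) * q ^ (i.1 + i.2)) (A * B) := by
  have h3 : Summable fun i : ℕ × ℕ => ((a i.1 : ℂ) * q ^ i.1) * ((b i.2 : ℂ) * q ^ i.2) :=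
    summable_mul_of_summable_norm (f := fun n => (a n : ℂ) * q ^ n)
      (g := fun n => (b n : ℂ) * q ^ n) h1.summable.norm h2.summable.norm
  have h5 := HasSum.mul (f := fun n => (a n : ℂ) * q ^ n) (g := fun n => (b n : ℂ) * q ^ n) h1 h2 h3
  refine (congrArg (HasSum · _) (funext fun i => ?_)).mpr h5
  push_cast
  ring

/-- `f` is given on the punctured unit disc by a power series with nonnegative coefficients. -/
def NonnegSeries (f : ℂ → ℂ) : Prop :=
  ∃ c : ℕ → ℝ, (∀ n, 0 ≤ c n) ∧
    ∀ q : ℂ, q ≠ 0 → ‖q‖ < 1 → HasSum (fun n => (c n : ℂ) * q ^ n) (f q)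

namespace NonnegSeries

variable {f g : ℂ → ℂ}

lemma of_hasSum {ι : Type*} {c : ι → ℝ} {e : ι → ℕ} (hc : ∀ i, 0 ≤ c i)
    (h : ∀ q : ℂ, q ≠ 0 → ‖q‖ < 1 → HasSum (fun i => (c i : ℂ) * q ^ e i) (f q)) :
    NonnegSeries f := by
  refine ⟨fun n => ∑' i : {i // e i = n}, c i, fun n => tsum_nonneg fun i => hc i,
    fun q hq0 hq => ?_⟩
  refine ((Equiv.sigmaFiberEquiv e).hasSum_iff.mpr (h q hq0 hq)).sigma fun n => ?_
  have h1 : Summable fun i : {i // e i = n} => (c i : ℂ) * (1 / 2) ^ e i :=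
    (h (1 / 2) (by norm_num) (by norm_num)).summable.subtype _
  have h2 : Summable fun i : {i // e i = n} => (c i : ℂ) := by
    refine (h1.mul_right (2 ^ n)).congr fun i => ?_
    rw [i.2, mul_assoc, ← mul_pow]
    norm_num
  have h3 : Summable fun i : {i // e i = n} => c i := by
    exact_mod_cast h2
  have h4 := (Complex.hasSum_ofReal.mpr h3.hasSum).mul_right (q ^ n)
  refine (congrArg (HasSum · _) (funext fun i => ?_)).mpr h4
  simp [Equiv.sigmaFiberEquiv, i.2]

lemma congr (hf : NonnegSeries f) (h : ∀ q : ℂ, q ≠ 0 → ‖q‖ < 1 → g q = f q) :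
    NonnegSeries g := by
  obtain ⟨c, hc, hs⟩ := hf
  exact ⟨c, hc, fun q hq0 hq => h q hq0 hq ▸ hs q hq0 hq⟩

protected lemma one : NonnegSeries fun _ => 1 :=
  of_hasSum (ι := Unit) (c := fun _ => 1) (e := fun _ => 0) (fun _ => zero_le_one)
    fun q _ _ => by simp

protected lemma mul (hf : NonnegSeries f) (hg : NonnegSeries g) :
    NonnegSeries fun q => f q * g q := by
  obtain ⟨a, ha, hfa⟩ := hf
  obtain ⟨b, hb, hgb⟩ := hg
  refine of_hasSum (ι := ℕ × ℕ) (c := fun i => a i.1 * b i.2) (e := fun i => i.1 + i.2)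
    (fun i => mul_nonneg (ha i.1) (hb i.2)) fun q hq0 hq => hasSum_mul_pow (hfa q hq0 hq) (hgb q hq0 hq)

protected lemma prod {ι : Type*} {f : ι → ℂ → ℂ} (s : Finset ι)
    (h : ∀ i ∈ s, NonnegSeries (f i)) : NonnegSeries fun q => ∏ i ∈ s, f i q := by
  classical
  induction s using Finset.induction_on with
  | empty => simpa using NonnegSeries.one
  | insert i s hi ih =>
    simp only [prod_insert hi]
    exact (h i (mem_insert_self i s)).mul (ih fun j hj => h j (mem_insert_of_mem hj))

protected lemma pow (hf : NonnegSeries f) (n : ℕ) : NonnegSeries fun q => f q ^ n := by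
  simpa using NonnegSeries.prod (range n) fun _ _ => hf

lemma comp_pow (hf : NonnegSeries f) {k : ℕ} (hk : k ≠ 0) : NonnegSeries fun q => f (q ^ k) := by
  obtain ⟨a, ha, hfa⟩ := hf
  refine of_hasSum (c := a) (e := fun n => k * n) ha fun q hq0 hq => ?_
  simpa only [pow_mul] using hfa (q ^ k) (pow_ne_zero k hq0)
    (by rw [norm_pow]; exact pow_lt_one₀ (norm_nonneg q) hq hk)

end NonnegSeries

/-- A product of absolutely convergent series is the sum of the family of products. -/
lemma summable_norm_and_hasSum_pi {ι R : Type*} [NormedCommRing R] [NormOneClass R]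
    [CompleteSpace R] {s : ℕ} {f : Fin s → ι → R} (hf : ∀ i, Summable fun m => ‖f i m‖) :
    (Summable fun n : Fin s → ι => ‖∏ i, f i (n i)‖) ∧
      HasSum (fun n : Fin s → ι => ∏ i, f i (n i)) (∏ i, ∑' m, f i m) := by
  induction s with
  | zero =>
    refine ⟨Summable.of_finite, ?_⟩
    simp
  | succ s ih =>
    obtain ⟨h1, h2⟩ := ih (f := fun i => f i.succ) fun i => hf i.succ
    have h3 := Summable.mul_norm (hf 0) h1
    have h5 := HasSum.mul (hf 0).of_norm.hasSum h2 h3.of_norm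
    have h4 : ∀ x : ι × (Fin s → ι), ∏ i, f i (Fin.consEquiv (fun _ => ι) x i) =
        f 0 x.1 * ∏ i, f i.succ (x.2 i) := fun x => by
      simp [Fin.consEquiv, Fin.prod_univ_succ]
    constructor
    · rw [← (Fin.consEquiv fun _ => ι).summable_iff]
      simpa only [Function.comp_def, h4] using h3
    · rw [← (Fin.consEquiv fun _ => ι).hasSum_iff, Fin.prod_univ_succ]
      simp only [Function.comp_def, h4]
      exact h5

/-- The quadratic form governing the `(s + 1)`-core lattice sum. -/
def coreExp {s : ℕ} (n : Fin s → ℤ) : ℤ :=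
  ∑ i, ((s + 1) * tri (n i) + (i + 1) * n i) - tri (∑ i, n i) - ∑ i, n i

lemma coreExp_succ {s : ℕ} (n : Fin (s + 1) → ℤ) :
    coreExp n = coreExp (fun i => n i.castSucc) + tri (n (Fin.last s)) +
      ∑ i : Fin s, tri (n i.castSucc - n (Fin.last s)) := by
  have h : ∑ i : Fin s, ((((s + 1 : ℕ) : ℤ) + 1) * tri (n i.castSucc) +
      (((i.castSucc : Fin (s + 1)) : ℤ) + 1) * n i.castSucc) =
      ∑ i : Fin s, (((s : ℤ) + 1) * tri (n i.castSucc) + ((i : ℤ) + 1) * n i.castSucc) +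
        ∑ i : Fin s, tri (n i.castSucc) := by
    rw [← sum_add_distrib]
    refine sum_congr rfl fun i _ => ?_
    push_cast
    simp only [Fin.val_castSucc]
    ring
  simp only [coreExp, Fin.sum_univ_castSucc (n := s), h, tri_sub, tri_add, sum_add_distrib,
    sum_sub_distrib, ← sum_mul, sum_const, card_univ, Fintype.card_fin, nsmul_eq_mul, Fin.val_last]
  push_cast
  ring

lemma sum_tri_le_coreExp {s : ℕ} (n : Fin s → ℤ) : ∑ i, tri (n i) ≤ coreExp n := by
  induction s with
  | zero => simp [coreExp]
  | succ s ih =>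
    rw [coreExp_succ, Fin.sum_univ_castSucc]
    have h1 := ih fun i => n i.castSucc
    have h2 : 0 ≤ ∑ i : Fin s, tri (n i.castSucc - n (Fin.last s)) :=
      sum_nonneg fun i _ => tri_nonneg _
    linarith

lemma coreExp_nonneg {s : ℕ} (n : Fin s → ℤ) : 0 ≤ coreExp n :=
  (sum_nonneg fun _ _ => tri_nonneg _).trans (sum_tri_le_coreExp n)

lemma coreExp_add_sum_nonneg {s : ℕ} (n : Fin s → ℤ) : 0 ≤ coreExp n + ∑ i, n i := by
  induction s with
  | zero => simp [coreExp]
  | succ s ih =>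
    rw [coreExp_succ, Fin.sum_univ_castSucc]
    have h1 := ih fun i => n i.castSucc
    have h2 : 0 ≤ ∑ i : Fin s, tri (n i.castSucc - n (Fin.last s)) :=
      sum_nonneg fun i _ => tri_nonneg _
    have h3 := tri_nonneg (0 - n (Fin.last s))
    rw [tri_sub] at h3
    simp only [tri_zero] at h3
    linarith

/-- The two-variable generating series of the `(s + 1)`-core lattice. -/
noncomputable def coreSeries (s : ℕ) (z q : ℂ) : ℂ :=
  ∑' n : Fin s → ℤ, z ^ (∑ i, n i) * q ^ coreExp n

lemma zpow_sum {ι G : Type*} [CommGroupWithZero G] {a : G} (ha : a ≠ 0) (s : Finset ι)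
    (f : ι → ℤ) : a ^ (∑ i ∈ s, f i) = ∏ i ∈ s, a ^ f i := by
  classical
  induction s using Finset.induction_on with
  | empty => simp
  | insert i s hi ih => rw [sum_insert hi, prod_insert hi, zpow_add₀ ha, ih]

lemma norm_coreSeries_term_le {s : ℕ} {z q : ℂ} (hz : z ≠ 0) (hq0 : q ≠ 0) (hq : ‖q‖ < 1)
    (n : Fin s → ℤ) :
    ‖z ^ (∑ i, n i) * q ^ coreExp n‖ ≤ ∏ i, ‖z‖ ^ n i * ‖q‖ ^ tri (n i) := by
  have h1 : ‖z‖ ≠ 0 := norm_ne_zero_iff.mpr hz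
  have h2 : ‖q‖ ≠ 0 := norm_ne_zero_iff.mpr hq0
  rw [norm_mul, norm_zpow, norm_zpow, zpow_sum h1, prod_mul_distrib, ← zpow_sum h2]
  gcongr _ * ?_
  exact zpow_le_zpow_right_of_le_one₀ (norm_pos_iff.mpr hq0) hq.le (sum_tri_le_coreExp n)

lemma summable_norm_coreSeries {s : ℕ} {z q : ℂ} (hz : z ≠ 0) (hq0 : q ≠ 0) (hq : ‖q‖ < 1) :
    Summable fun n : Fin s → ℤ => ‖z ^ (∑ i, n i) * q ^ coreExp n‖ := by
  have h := (summable_norm_and_hasSum_pi (s := s)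
    (f := fun _ (m : ℤ) => ‖z‖ ^ m * ‖q‖ ^ tri m) fun _ =>
      (summable_real_theta (norm_pos_iff.mpr hz) (norm_pos_iff.mpr hq0) hq).norm).1.of_norm
  exact h.of_nonneg_of_le (fun _ => norm_nonneg _) fun n => norm_coreSeries_term_le hz hq0 hq n

lemma zpow_le_two_zpow_add {x : ℝ} (h1 : 1 / 2 ≤ x) (h2 : x ≤ 2) (m : ℤ) :
    x ^ m ≤ 2 ^ m + 2⁻¹ ^ m := by
  have hx : 0 < x := by linarith
  have h3 : (0 : ℝ) < 2 ^ m := by positivity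
  have h4 : (0 : ℝ) < 2⁻¹ ^ m := by positivity
  rcases le_total 0 m with hm | hm
  · have := zpow_le_zpow_left₀ hm hx.le h2
    linarith
  · have h5 : x⁻¹ ≤ 2 := by
      rw [inv_le_comm₀ hx two_pos]
      linarith
    have := zpow_le_zpow_left₀ (neg_nonneg.mpr hm) (by positivity) h5
    rw [zpow_neg, ← inv_zpow, inv_inv, zpow_neg, ← inv_zpow] at this
    linarith

lemma tendsto_coreSeries (s : ℕ) {q : ℂ} (hq0 : q ≠ 0) (hq : ‖q‖ < 1) :
    Tendsto (fun z => coreSeries s z q) (𝓝 1) (𝓝 (coreSeries s 1 q)) := by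
  have hr : 0 < ‖q‖ := norm_pos_iff.mpr hq0
  have hs : Summable fun m : ℤ => ((2 : ℝ) ^ m + 2⁻¹ ^ m) * ‖q‖ ^ tri m := by
    simpa only [add_mul] using (summable_real_theta two_pos hr hq).add
      (summable_real_theta (x := 2⁻¹) (by norm_num) hr hq)
  refine tendsto_tsum_of_dominated_convergence
    (bound := fun n : Fin s → ℤ => ∏ i, ((2 : ℝ) ^ n i + 2⁻¹ ^ n i) * ‖q‖ ^ tri (n i))
    (summable_norm_and_hasSum_pi fun _ => hs.norm).1.of_norm (fun n => ?_) ?_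
  · exact ((continuousAt_zpow₀ (1 : ℂ) _ (Or.inl one_ne_zero)).tendsto).mul_const _
  · filter_upwards [Metric.ball_mem_nhds (1 : ℂ) (ε := 1 / 2) (by norm_num)] with z hz n
    rw [Metric.mem_ball, dist_eq_norm] at hz
    have h1 := norm_sub_norm_le 1 z
    have h2 := norm_sub_norm_le z 1
    rw [norm_sub_rev] at h1
    rw [norm_one] at h1 h2
    have hz0 : z ≠ 0 := by
      rintro rfl
      norm_num at hz
    refine (norm_coreSeries_term_le hz0 hq0 hq n).trans ?_
    gcongr with i
    exact zpow_le_two_zpow_add (by linarith) (by linarith) _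

lemma theta_zpow_self (c : ℤ) {q : ℂ} (hq0 : q ≠ 0) : theta (q ^ c) q = 0 := by
  have h1 : theta (q ^ c) q = -theta (q ^ c) q := by
    nth_rewrite 1 [theta]
    rw [← (Equiv.subLeft (1 - 2 * c)).tsum_eq, theta, ← tsum_neg]
    refine tsum_congr fun n => ?_
    rw [Equiv.subLeft_apply, ← zpow_mul, ← zpow_mul, mul_assoc, mul_assoc, ← zpow_add₀ hq0,
      ← zpow_add₀ hq0]
    have h2 : c * (1 - 2 * c - n) + tri (1 - 2 * c - n) = c * n + tri n := by
      have h3 := two_mul_tri (1 - 2 * c - n)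
      have h4 := two_mul_tri n
      linarith
    have h3 : (-1 : ℂ) ^ (1 - 2 * c - n) = -(-1) ^ n := by
      rw [zpow_sub₀ (by norm_num), zpow_sub₀ (by norm_num), zpow_mul]
      rcases Int.even_or_odd n with h | h <;> simp [h.neg_one_zpow]
    rw [h2, h3, neg_mul]
  linear_combination h1 / 2

lemma theta_mul_zpow {w q : ℂ} (hw : w ≠ 0) (hq0 : q ≠ 0) (l : ℤ) :
    theta (w * q ^ (-l)) q = (-1) ^ l * w ^ l * q ^ (tri l - l * l) * theta w q := by
  rw [theta, ← (Equiv.addRight l).tsum_eq, theta, ← tsum_mul_left]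
  refine tsum_congr fun n => ?_
  have h1 : tri l - l * l + tri n = -l * (n + l) + tri (n + l) := by
    rw [tri_add]
    ring
  rw [Equiv.coe_addRight, mul_zpow, ← zpow_mul, zpow_add₀ (show (-1 : ℂ) ≠ 0 by norm_num),
    zpow_add₀ hw]
  calc _ = (-1) ^ n * (-1) ^ l * (w ^ n * w ^ l) * (q ^ (-l * (n + l)) * q ^ tri (n + l)) := by
        ring
    _ = (-1) ^ n * (-1) ^ l * (w ^ n * w ^ l) * (q ^ (tri l - l * l) * q ^ tri n) := by
        rw [← zpow_add₀ hq0, ← zpow_add₀ hq0, h1]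
    _ = _ := by ring

/-- The sum over the slice `∑ nᵢ + j = m` in the product of `coreSeries` and `theta`, up to the
factor `(-1)ᵐ zᵐ q^{m(m-1)/2}`. -/
noncomputable def sliceSum (s : ℕ) (q : ℂ) (m : ℤ) : ℂ :=
  ∏ i : Fin s, theta (q ^ ((i : ℤ) + 1 - m)) (q ^ (s + 1))

lemma neg_one_zpow_sub_sum {s : ℕ} (m : ℤ) (n : Fin s → ℤ) :
    (-1 : ℂ) ^ (m - ∑ i, n i) = (-1) ^ m * ∏ i, (-1) ^ n i := by
  rw [← zpow_sum (by norm_num), zpow_sub₀ (by norm_num)]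
  rcases Int.even_or_odd (∑ i, n i) with h | h <;> simp [h.neg_one_zpow, div_neg]

lemma slice_exponent {s : ℕ} (m : ℤ) (n : Fin s → ℤ) :
    coreExp n + tri (m - ∑ i, n i) =
      tri m + ∑ i : Fin s, (((i : ℤ) + 1 - m) * n i + (s + 1) * tri (n i)) := by
  have h : ∀ i : Fin s, ((i : ℤ) + 1 - m) * n i + (s + 1) * tri (n i) =
      (s + 1) * tri (n i) + (i + 1) * n i - m * n i := fun i => by ring
  simp only [h, sum_sub_distrib, ← mul_sum, tri_sub]
  rw [coreExp]
  ring

lemma hasSum_slices {s : ℕ} {z q : ℂ} (hz : z ≠ 0) (hq0 : q ≠ 0) (hq : ‖q‖ < 1) :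
    HasSum (fun m : ℤ => (-1) ^ m * z ^ m * q ^ tri m * sliceSum s q m)
      (coreSeries s z q * theta z q) := by
  have hsum := Summable.mul_norm (summable_norm_coreSeries (s := s) hz hq0 hq)
    (summable_norm_theta hz hq0 hq)
  have h1 := HasSum.mul (summable_norm_coreSeries (s := s) hz hq0 hq).of_norm.hasSum
    (summable_norm_theta hz hq0 hq).of_norm.hasSum hsum.of_norm
  have hqs : ‖q ^ (s + 1)‖ < 1 := by
    rw [norm_pow]
    exact pow_lt_one₀ (norm_nonneg q) hq s.succ_ne_zero
  let e : ℤ × (Fin s → ℤ) ≃ (Fin s → ℤ) × ℤ :=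
    { toFun := fun x => (x.2, x.1 - ∑ i, x.2 i)
      invFun := fun x => (x.2 + ∑ i, x.1 i, x.1)
      left_inv := fun x => by simp
      right_inv := fun x => by simp }
  have h2 := e.hasSum_iff.mpr h1
  refine h2.prod_fiberwise fun m => ?_
  have h3 := (summable_norm_and_hasSum_pi (s := s)
    (f := fun (i : Fin s) (n : ℤ) =>
      (-1) ^ n * (q ^ ((i : ℤ) + 1 - m)) ^ n * (q ^ (s + 1)) ^ tri n)
    fun i => summable_norm_theta (zpow_ne_zero _ hq0) (pow_ne_zero _ hq0) hqs).2
  refine (congrArg (HasSum · _) (funext fun n => ?_)).mpr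
    (h3.mul_left ((-1) ^ m * z ^ m * q ^ tri m))
  have h4 : ∏ i : Fin s, (-1 : ℂ) ^ n i * (q ^ ((i : ℤ) + 1 - m)) ^ n i *
      (q ^ (s + 1)) ^ tri (n i) = (∏ i, (-1) ^ n i) *
      q ^ ∑ i : Fin s, (((i : ℤ) + 1 - m) * n i + (s + 1) * tri (n i)) := by
    rw [zpow_sum hq0, ← prod_mul_distrib]
    refine prod_congr rfl fun i _ => ?_
    rw [zpow_add₀ hq0, zpow_mul, zpow_mul, mul_assoc]
    norm_cast
  rw [h4]
  simp only [e, Function.comp_apply, Equiv.coe_fn_mk]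
  calc _ = (-1) ^ (m - ∑ i, n i) * (z ^ (∑ i, n i) * z ^ (m - ∑ i, n i)) *
        (q ^ coreExp n * q ^ tri (m - ∑ i, n i)) := by ring
    _ = _ := by
      rw [← zpow_add₀ hz, ← zpow_add₀ hq0, slice_exponent, zpow_add₀ hq0, neg_one_zpow_sub_sum,
        add_sub_cancel]
      ring

lemma sliceSum_eq_zero {s : ℕ} {q : ℂ} (hq0 : q ≠ 0) {m : ℤ} (hm : ¬ ((s + 1 : ℕ) : ℤ) ∣ m) :
    sliceSum s q m = 0 := by
  have h1 : 0 ≤ m % (s + 1 : ℕ) := Int.emod_nonneg _ (by positivity)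
  have h2 : m % (s + 1 : ℕ) < (s + 1 : ℕ) := Int.emod_lt_of_pos _ (by positivity)
  have h3 : m % (s + 1 : ℕ) ≠ 0 := fun h => hm (Int.dvd_of_emod_eq_zero h)
  obtain ⟨r, hr⟩ : ∃ r : ℕ, m % (s + 1 : ℕ) = r + 1 :=
    ⟨(m % (s + 1 : ℕ) - 1).toNat, by omega⟩
  have h5 := Int.emod_add_mul_ediv m (s + 1 : ℕ)
  refine prod_eq_zero (mem_univ (⟨r, by omega⟩ : Fin s)) ?_
  have h6 : ((r : ℤ) + 1 - m) = (s + 1 : ℕ) * (-(m / (s + 1 : ℕ))) := by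
    rw [hr] at h5
    linear_combination h5
  rw [h6, zpow_mul, zpow_natCast]
  exact theta_zpow_self _ (pow_ne_zero _ hq0)

lemma sum_fin_succ (s : ℕ) : ∑ i : Fin s, ((i : ℤ) + 1) = tri (s + 1) := by
  induction s with
  | zero => simp [tri]
  | succ s ih =>
    rw [Fin.sum_univ_castSucc]
    simp only [Fin.val_castSucc, ih, Fin.val_last]
    push_cast
    rw [tri_add (s + 1) 1]
    simp [tri]

lemma term_mul_sliceSum {s : ℕ} {z q : ℂ} (hq0 : q ≠ 0) (l : ℤ) :
    (-1) ^ ((s + 1 : ℕ) * l) * z ^ ((s + 1 : ℕ) * l) * q ^ tri ((s + 1 : ℕ) * l) *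
        sliceSum s q ((s + 1 : ℕ) * l) =
      sliceSum s q 0 * ((-1) ^ l * (z ^ (s + 1)) ^ l * (q ^ (s + 1)) ^ tri l) := by
  have h1 : sliceSum s q ((s + 1 : ℕ) * l) =
      ((-1) ^ l) ^ s * q ^ (l * tri (s + 1) + s * ((s + 1) * (tri l - l * l))) *
        sliceSum s q 0 := by
    have h2 : ∀ i : Fin s, theta (q ^ ((i : ℤ) + 1 - (s + 1 : ℕ) * l)) (q ^ (s + 1)) =
        (-1) ^ l * q ^ (l * ((i : ℤ) + 1) + (s + 1) * (tri l - l * l)) *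
          theta (q ^ ((i : ℤ) + 1 - 0)) (q ^ (s + 1)) := fun i => by
      have h3 := theta_mul_zpow (zpow_ne_zero ((i : ℤ) + 1) hq0) (pow_ne_zero (s + 1) hq0) l
      rw [← zpow_natCast q (s + 1), ← zpow_mul, ← zpow_mul, ← zpow_mul, ← zpow_add₀ hq0,
        mul_assoc ((-1) ^ l), ← zpow_add₀ hq0] at h3
      rw [sub_zero, ← zpow_natCast q (s + 1)]
      convert h3 using 3
      · ring
      · push_cast
        ring_nf
    rw [sliceSum, prod_congr rfl fun i _ => h2 i, prod_mul_distrib, prod_mul_distrib,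
      ← zpow_sum hq0, sum_add_distrib, ← mul_sum, sum_fin_succ]
    simp [sliceSum]
  have h4 : tri ((s + 1 : ℕ) * l) + (l * tri (s + 1) + s * ((s + 1) * (tri l - l * l))) =
      (s + 1 : ℕ) * tri l := by
    have h5 := two_mul_tri ((s + 1 : ℕ) * l)
    have h6 := two_mul_tri (s + 1)
    have h7 := two_mul_tri l
    push_cast at *
    refine mul_left_cancel₀ two_ne_zero ?_
    linear_combination h5 + l * h6 + (s + 1) * (s - 1) * h7
  have h8 : (-1 : ℂ) ^ ((s + 1 : ℕ) * l) * ((-1) ^ l) ^ s = (-1) ^ l := by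
    rw [mul_comm _ l, zpow_mul, zpow_natCast, ← pow_add]
    rcases Int.even_or_odd l with h | h
    · simp [h.neg_one_zpow]
    · rw [h.neg_one_zpow]
      exact Odd.neg_one_pow ⟨s, by ring⟩
  rw [h1]
  calc _ = ((-1) ^ ((s + 1 : ℕ) * l) * ((-1) ^ l) ^ s) * z ^ ((s + 1 : ℕ) * l) *
        (q ^ tri ((s + 1 : ℕ) * l) *
          q ^ (l * tri (s + 1) + s * ((s + 1) * (tri l - l * l)))) * sliceSum s q 0 := by ring
    _ = _ := by
      rw [h8, ← zpow_add₀ hq0, h4, zpow_mul, zpow_mul, zpow_natCast, zpow_natCast]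
      ring

lemma coreSeries_mul_theta {s : ℕ} {z q : ℂ} (hz : z ≠ 0) (hq0 : q ≠ 0) (hq : ‖q‖ < 1) :
    coreSeries s z q * theta z q = sliceSum s q 0 * theta (z ^ (s + 1)) (q ^ (s + 1)) := by
  have h0 : ((s + 1 : ℕ) : ℤ) ≠ 0 := by positivity
  have h1 := (Function.Injective.hasSum_iff (mul_right_injective₀ h0) fun m hm => ?_).mpr
    (hasSum_slices (s := s) hz hq0 hq)
  · rw [← h1.tsum_eq, theta, ← tsum_mul_left]
    exact tsum_congr fun l => term_mul_sliceSum hq0 l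
  · rw [sliceSum_eq_zero hq0, mul_zero]
    rintro ⟨l, rfl⟩
    exact hm ⟨l, rfl⟩

/-- Splitting `E(q)` according to residue classes modulo `t`. -/
lemma prod_qPoch_residues {q : ℂ} (hq : ‖q‖ < 1) {t : ℕ} (ht : t ≠ 0) :
    ∏ r ∈ range t, qPoch (q ^ (r + 1)) (q ^ t) = Eprod q := by
  have hqt : ‖q ^ t‖ < 1 := by
    rw [norm_pow]
    exact pow_lt_one₀ (norm_nonneg q) hq ht
  have h1 : Tendsto (fun N => ∏ r ∈ range t, ∏ i ∈ range N, (1 - q ^ (r + 1) * (q ^ t) ^ i))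
      atTop (𝓝 (∏ r ∈ range t, qPoch (q ^ (r + 1)) (q ^ t))) :=
    tendsto_finsetProd _ fun r _ => tendsto_qPoch _ hqt
  have h2 := (tendsto_Eprod hq).comp
    (tendsto_atTop_mono (f := id) (g := fun N => t * N)
      (fun N => Nat.le_mul_of_pos_left N (Nat.pos_of_ne_zero ht)) tendsto_id)
  refine tendsto_nhds_unique h1 (h2.congr fun N => ?_)
  simp only [Function.comp_apply]
  rw [Finset.prod_comm]
  induction N with
  | zero => simp
  | succ N ih =>
    rw [Nat.mul_succ, prod_range_add, ih, prod_range_succ _ N]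
    congr 1
    refine prod_congr rfl fun r _ => ?_
    rw [← pow_mul, ← pow_add]
    congr 2
    ring

lemma norm_pow_lt_one {q : ℂ} (hq : ‖q‖ < 1) {k : ℕ} (hk : k ≠ 0) : ‖q ^ k‖ < 1 := by
  rw [norm_pow]
  exact pow_lt_one₀ (norm_nonneg q) hq hk

lemma sliceSum_zero_mul {s : ℕ} {q : ℂ} (hq0 : q ≠ 0) (hq : ‖q‖ < 1) :
    sliceSum s q 0 * Eprod (q ^ (s + 1)) ^ 2 = Eprod (q ^ (s + 1)) ^ s * Eprod q ^ 2 := by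
  have hqt := norm_pow_lt_one hq s.succ_ne_zero
  have h1 : ∀ i ∈ range s, theta (q ^ ((i : ℤ) + 1 - 0)) (q ^ (s + 1)) =
      Eprod (q ^ (s + 1)) * (qPoch (q ^ (i + 1)) (q ^ (s + 1)) *
        qPoch (q ^ (s - 1 - i + 1)) (q ^ (s + 1))) := fun i hi => by
    have h2 : q ^ ((i : ℤ) + 1 - 0) = q ^ (i + 1) := by
      rw [sub_zero]
      norm_cast
    have h3 : q ^ (s + 1) / q ^ (i + 1) = q ^ (s - 1 - i + 1) := by
      rw [div_eq_iff (pow_ne_zero _ hq0), ← pow_add]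
      congr 1
      have := mem_range.mp hi
      omega
    rw [h2, theta_eq_qPoch (pow_ne_zero _ hq0) (pow_ne_zero _ hq0) hqt, h3]
  have h4 := prod_qPoch_residues hq s.succ_ne_zero
  rw [prod_range_succ, ← Eprod_eq_qPoch] at h4
  rw [sliceSum, Fin.prod_univ_eq_prod_range
    (fun i => theta (q ^ ((i : ℤ) + 1 - 0)) (q ^ (s + 1))) s, prod_congr rfl h1,
    prod_mul_distrib, prod_mul_distrib,
    prod_range_reflect (fun i => qPoch (q ^ (i + 1)) (q ^ (s + 1))) s, ← h4]
  simp only [prod_const, card_range]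
  ring

/-- The product formula for the two-variable generating series of the `(s + 1)`-core lattice. -/
lemma coreSeries_mul_qPoch {s : ℕ} {z q : ℂ} (hz : z ≠ 0) (hq0 : q ≠ 0) (hq : ‖q‖ < 1) :
    coreSeries s z q * (qPoch z q * qPoch (q / z) q) * Eprod (q ^ (s + 1)) =
      Eprod (q ^ (s + 1)) ^ s * Eprod q *
        (qPoch (z ^ (s + 1)) (q ^ (s + 1)) * qPoch ((q / z) ^ (s + 1)) (q ^ (s + 1))) := by
  have hqt := norm_pow_lt_one hq s.succ_ne_zero
  have h1 := coreSeries_mul_theta (s := s) hz hq0 hq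
  rw [theta_eq_qPoch hz hq0 hq,
    theta_eq_qPoch (pow_ne_zero _ hz) (pow_ne_zero _ hq0) hqt, ← div_pow] at h1
  have h2 := sliceSum_zero_mul (s := s) hq0 hq
  refine mul_left_cancel₀ (Eprod_ne_zero hq) ?_
  linear_combination Eprod (q ^ (s + 1)) * h1 +
    qPoch (z ^ (s + 1)) (q ^ (s + 1)) * qPoch ((q / z) ^ (s + 1)) (q ^ (s + 1)) * h2

lemma coreSeries_one_mul_Eprod {s : ℕ} {q : ℂ} (hq0 : q ≠ 0) (hq : ‖q‖ < 1) :
    coreSeries s 1 q * Eprod q = (s + 1) * Eprod (q ^ (s + 1)) ^ (s + 1) := by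
  have hqt := norm_pow_lt_one hq s.succ_ne_zero
  have h1 : ∀ᶠ z : ℂ in 𝓝[≠] 1,
      coreSeries s z q * (qPoch (z * q) q * qPoch (q / z) q) * Eprod (q ^ (s + 1)) =
      Eprod (q ^ (s + 1)) ^ s * Eprod q * ((∑ j ∈ range (s + 1), z ^ j) *
        (qPoch (z ^ (s + 1) * q ^ (s + 1)) (q ^ (s + 1)) *
          qPoch ((q / z) ^ (s + 1)) (q ^ (s + 1)))) := by
    filter_upwards [self_mem_nhdsWithin,
      nhdsWithin_le_nhds (isOpen_ne.mem_nhds (one_ne_zero (α := ℂ)))] with z hz1 hz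
    have h2 := coreSeries_mul_qPoch (s := s) hz hq0 hq
    rw [qPoch_eq_mul z hq, qPoch_eq_mul (z ^ (s + 1)) hqt, ← mul_neg_geom_sum z (s + 1)] at h2
    refine mul_left_cancel₀ (sub_ne_zero.mpr (Ne.symm hz1)) ?_
    linear_combination h2
  have hc : Tendsto (fun z : ℂ => coreSeries s z q) (𝓝[≠] 1) (𝓝 (coreSeries s 1 q)) :=
    (tendsto_coreSeries s hq0 hq).mono_left nhdsWithin_le_nhds
  have hdiv : ContinuousAt (fun z : ℂ => q / z) 1 :=
    continuousAt_const.div continuousAt_id one_ne_zero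
  have hp : ∀ {g : ℂ → ℂ} {p : ℂ}, ‖p‖ < 1 → ContinuousAt g 1 →
      Tendsto (fun z => qPoch (g z) p) (𝓝[≠] 1) (𝓝 (qPoch (g 1) p)) := fun hp' hg =>
    (((continuous_qPoch hp').continuousAt.comp hg).tendsto).mono_left nhdsWithin_le_nhds
  have hl := (hc.mul ((hp hq (g := fun z => z * q) (by fun_prop)).mul (hp hq hdiv))).mul_const
    (Eprod (q ^ (s + 1)))
  have hs : Tendsto (fun z : ℂ => ∑ j ∈ range (s + 1), z ^ j) (𝓝[≠] 1)
      (𝓝 (∑ j ∈ range (s + 1), 1 ^ j)) :=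
    (Continuous.tendsto (by fun_prop) _).mono_left nhdsWithin_le_nhds
  have hr := (hs.mul ((hp hqt (g := fun z => z ^ (s + 1) * q ^ (s + 1)) (by fun_prop)).mul
    (hp hqt (hdiv.pow (s + 1))))).const_mul (Eprod (q ^ (s + 1)) ^ s * Eprod q)
  have h3 := tendsto_nhds_unique (hl.congr' h1) hr
  simp only [one_pow, one_mul, div_one, sum_const, card_range, nsmul_eq_mul, mul_one,
    ← Eprod_eq_qPoch, Pi.pow_apply] at h3
  push_cast at h3
  refine mul_left_cancel₀ (mul_ne_zero (Eprod_ne_zero hq) (Eprod_ne_zero hqt)) ?_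
  linear_combination h3

/-- The generating series of `t`-cores has nonnegative coefficients. -/
lemma NonnegSeries.core {t : ℕ} (ht : t ≠ 0) :
    NonnegSeries fun q => Eprod (q ^ t) ^ t / Eprod q := by
  obtain ⟨s, rfl⟩ := Nat.exists_eq_succ_of_ne_zero ht
  refine of_hasSum (ι := Fin s → ℤ) (c := fun _ => ((s : ℝ) + 1)⁻¹)
    (e := fun n => (coreExp n).toNat) (fun _ => by positivity) fun q hq0 hq => ?_
  have h1 := coreSeries_one_mul_Eprod (s := s) hq0 hq
  have hs : (s : ℂ) + 1 ≠ 0 := by exact_mod_cast s.succ_ne_zero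
  have h2 : Eprod (q ^ s.succ) ^ s.succ / Eprod q = ((s : ℂ) + 1)⁻¹ * coreSeries s 1 q := by
    rw [div_eq_iff (Eprod_ne_zero hq), mul_assoc, h1, Nat.succ_eq_add_one]
    field_simp
  rw [h2]
  refine (congrArg (HasSum · _) (funext fun n => ?_)).mpr
    ((summable_norm_coreSeries one_ne_zero hq0 hq).of_norm.hasSum.mul_left ((s : ℂ) + 1)⁻¹)
  rw [one_zpow, one_mul, ← zpow_natCast, Int.toNat_of_nonneg (coreExp_nonneg n)]
  push_cast
  rfl

lemma NonnegSeries.coreSeries (s : ℕ) {a M : ℕ} (ha : a < M) :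
    NonnegSeries fun q => coreSeries s (q ^ a) (q ^ M) := by
  have hnn : ∀ n : Fin s → ℤ, 0 ≤ M * coreExp n + a * ∑ i, n i := fun n => by
    have h1 := coreExp_nonneg n
    have h2 := coreExp_add_sum_nonneg n
    have h3 : (0 : ℤ) ≤ (M : ℤ) - a := by omega
    have h4 := mul_nonneg h3 h1
    have h5 := mul_nonneg (Int.natCast_nonneg a) h2
    linarith
  refine of_hasSum (ι := Fin s → ℤ) (c := fun _ => 1)
    (e := fun n => (M * coreExp n + a * ∑ i, n i).toNat) (fun _ => zero_le_one)
    fun q hq0 hq => ?_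
  refine (congrArg (HasSum · _) (funext fun n => ?_)).mpr
    (summable_norm_coreSeries (s := s) (pow_ne_zero a hq0) (pow_ne_zero M hq0)
      (norm_pow_lt_one hq (by omega))).of_norm.hasSum
  rw [Complex.ofReal_one, one_mul, ← zpow_natCast, Int.toNat_of_nonneg (hnn n), zpow_add₀ hq0,
    zpow_mul, zpow_mul, zpow_natCast, zpow_natCast, mul_comm]

lemma NonnegSeries.qPoch_ratio {t : ℕ} (ht : t ≠ 0) {a M : ℕ} (ha0 : a ≠ 0) (ha : a < M) :
    NonnegSeries fun q =>
      Eprod (q ^ (M * t)) ^ (2 * (t - 1)) *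
        (qPoch (q ^ (a * t)) (q ^ (M * t)) * qPoch (q ^ ((M - a) * t)) (q ^ (M * t))) /
          (qPoch (q ^ a) (q ^ M) * qPoch (q ^ (M - a)) (q ^ M)) := by
  obtain ⟨s, rfl⟩ := Nat.exists_eq_succ_of_ne_zero ht
  refine ((NonnegSeries.coreSeries s ha).mul
    ((core ht).comp_pow (k := M) (by omega))).congr fun q hq0 hq => ?_
  have hM := norm_pow_lt_one hq (show M ≠ 0 by omega)
  have h1 := coreSeries_mul_qPoch (s := s) (pow_ne_zero a hq0) (pow_ne_zero M hq0) hM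
  have h2 : q ^ M / q ^ a = q ^ (M - a) := by
    rw [div_eq_iff (pow_ne_zero _ hq0), ← pow_add]
    congr 1
    omega
  simp only [h2, ← pow_mul] at h1
  have h3 := Eprod_ne_zero hM
  have h4 := qPoch_ne_zero_of_norm_lt hM (norm_pow_lt_one hq ha0)
  have h5 := qPoch_ne_zero_of_norm_lt hM (norm_pow_lt_one hq (show M - a ≠ 0 by omega))
  have h6 := Eprod_ne_zero (norm_pow_lt_one hq (show M * (s + 1) ≠ 0 by
    exact Nat.mul_ne_zero (by omega) (by omega)))
  rw [div_eq_iff (mul_ne_zero h4 h5)]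
  simp only [Nat.succ_eq_add_one, Nat.add_sub_cancel, ← pow_mul]
  refine mul_left_cancel₀ (mul_ne_zero h3 h6) ?_
  have h7 := div_mul_cancel₀ (Eprod (q ^ (M * (s + 1))) ^ (s + 1)) h3
  linear_combination -(Eprod (q ^ (M * (s + 1))) ^ (s + 1)) * h1 -
    (Eprod (q ^ (M * (s + 1))) * _root_.coreSeries s (q ^ a) (q ^ M) *
      (qPoch (q ^ a) (q ^ M) * qPoch (q ^ (M - a)) (q ^ M))) * h7

lemma sum_divisors_moebius {g : ℕ} :
    ∑ d ∈ g.divisors, ArithmeticFunction.moebius d = if g = 1 then 1 else 0 := by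
  rw [← ArithmeticFunction.coe_mul_zeta_apply, ArithmeticFunction.moebius_mul_coe_zeta,
    ArithmeticFunction.one_apply]

/-- The product `∏_{d ∣ N} E(q^d)^{μ(d)}`. -/
noncomputable def moebiusProd (N : ℕ) (q : ℂ) : ℂ :=
  ∏ d ∈ N.divisors, Eprod (q ^ d) ^ (ArithmeticFunction.moebius d)

lemma Eprod_pow_eq_prod {q : ℂ} (hq : ‖q‖ < 1) {d M : ℕ} (hM : M ≠ 0) (hd : d ∣ M) :
    Eprod (q ^ d) = ∏ n ∈ Ico 1 (1 + M) with d ∣ n, qPoch (q ^ n) (q ^ M) := by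
  obtain ⟨t, rfl⟩ := hd
  obtain ⟨hd0, ht0⟩ := mul_ne_zero_iff.mp hM
  rw [← prod_qPoch_residues (norm_pow_lt_one hq hd0) ht0]
  refine prod_nbij (fun r => d * (r + 1)) (fun r hr => ?_) (fun a _ b _ h => ?_)
    (fun n hn => ?_) fun r _ => ?_
  · have h1 : d * (r + 1) ≤ d * t := Nat.mul_le_mul_left d (mem_range.mp hr)
    have h2 : 0 < d * (r + 1) := by positivity
    simp only [mem_filter, mem_Ico, dvd_mul_right, and_true]
    omega
  · have := Nat.eq_of_mul_eq_mul_left (Nat.pos_of_ne_zero hd0) h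
    omega
  · simp only [coe_filter, mem_Ico, Set.mem_ofPred_eq] at hn
    obtain ⟨⟨h1, h2⟩, k, rfl⟩ := hn
    have hk : k ≠ 0 := by
      rintro rfl
      omega
    have hk' : k ≤ t := Nat.le_of_mul_le_mul_left (by omega) (Nat.pos_of_ne_zero hd0)
    refine ⟨k - 1, ?_, ?_⟩
    · simp only [coe_range, Set.mem_Iio]
      omega
    · simp only [Nat.sub_add_cancel (Nat.one_le_iff_ne_zero.mpr hk)]
  · rw [← pow_mul, ← pow_mul]

lemma qPoch_pow_ne_zero {q : ℂ} (hq : ‖q‖ < 1) {n M : ℕ} (hn : n ≠ 0) (hM : M ≠ 0) :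
    qPoch (q ^ n) (q ^ M) ≠ 0 :=
  qPoch_ne_zero_of_norm_lt (norm_pow_lt_one hq hM) (norm_pow_lt_one hq hn)

lemma moebiusProd_eq_prod_coprime {q : ℂ} (hq : ‖q‖ < 1) {M : ℕ} (hM : M ≠ 0) :
    moebiusProd M q = ∏ n ∈ Ico 1 (1 + M) with M.Coprime n, qPoch (q ^ n) (q ^ M) := by
  have h1 : ∀ d ∈ M.divisors, Eprod (q ^ d) ^ (ArithmeticFunction.moebius d) =
      ∏ n ∈ Ico 1 (1 + M),
        if d ∣ n then qPoch (q ^ n) (q ^ M) ^ (ArithmeticFunction.moebius d) else 1 :=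
    fun d hd => by
      rw [Eprod_pow_eq_prod hq hM (Nat.dvd_of_mem_divisors hd), ← prod_zpow, prod_filter]
  rw [moebiusProd, prod_congr rfl h1, Finset.prod_comm, prod_filter]
  refine prod_congr rfl fun n hn => ?_
  have hn0 : n ≠ 0 := by
    have := (mem_Ico.mp hn).1
    omega
  have h2 : M.divisors.filter (· ∣ n) = (M.gcd n).divisors := by
    ext d
    simp [Nat.dvd_gcd_iff, hM]
  rw [← prod_filter, h2, ← zpow_sum (qPoch_pow_ne_zero hq hn0 hM), sum_divisors_moebius]
  split_ifs <;> simp_all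

lemma moebiusProd_ne_zero {q : ℂ} (hq : ‖q‖ < 1) {M : ℕ} : moebiusProd M q ≠ 0 :=
  prod_ne_zero_iff.mpr fun _ hd =>
    zpow_ne_zero _ (Eprod_ne_zero (norm_pow_lt_one hq (Nat.pos_of_mem_divisors hd).ne'))

lemma moebiusProd_mul_of_dvd {p M : ℕ} (hp : p.Prime) (hM : M ≠ 0) (h : p ∣ M) (q : ℂ) :
    moebiusProd (p * M) q = moebiusProd M q := by
  refine (prod_subset (Nat.divisors_subset_of_dvd (mul_ne_zero hp.ne_zero hM)
    (dvd_mul_left M p)) fun d hd hd' => ?_).symm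
  rw [ArithmeticFunction.moebius_eq_zero_of_not_squarefree, zpow_zero]
  intro hsq
  refine hd' (Nat.mem_divisors.mpr ⟨?_, hM⟩)
  have hd := Nat.dvd_of_mem_divisors hd
  by_cases hpd : p ∣ d
  · obtain ⟨e, rfl⟩ := hpd
    have hco : Nat.Coprime p e := (Nat.squarefree_mul_iff.mp hsq).1
    exact hco.mul_dvd_of_dvd_of_dvd h (Nat.dvd_of_mul_dvd_mul_left hp.pos hd)
  · exact ((hp.coprime_iff_not_dvd.mpr hpd).symm).dvd_of_dvd_mul_left hd

lemma moebiusProd_mul_of_not_dvd {p M : ℕ} (hp : p.Prime) (hM : M ≠ 0) (h : ¬ p ∣ M) (q : ℂ) :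
    moebiusProd (p * M) q = moebiusProd M q / moebiusProd M (q ^ p) := by
  have hco : Nat.Coprime p M := hp.coprime_iff_not_dvd.mpr h
  have h1 : (p * M).divisors = M.divisors ∪ M.divisors.image (p * ·) := by
    ext d
    simp only [mem_union, mem_image, Nat.mem_divisors]
    constructor
    · rintro ⟨hd, -⟩
      by_cases hpd : p ∣ d
      · obtain ⟨e, rfl⟩ := hpd
        exact Or.inr ⟨e, ⟨Nat.dvd_of_mul_dvd_mul_left hp.pos hd, hM⟩, rfl⟩
      · exact Or.inl ⟨((hp.coprime_iff_not_dvd.mpr hpd).symm).dvd_of_dvd_mul_left hd, hM⟩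
    · rintro (⟨hd, -⟩ | ⟨e, ⟨he, -⟩, rfl⟩)
      · exact ⟨hd.mul_left p, mul_ne_zero hp.ne_zero hM⟩
      · exact ⟨Nat.mul_dvd_mul_left p he, mul_ne_zero hp.ne_zero hM⟩
  have h2 : Disjoint M.divisors (M.divisors.image (p * ·)) := by
    rw [Finset.disjoint_left]
    intro d hd hd'
    obtain ⟨e, -, rfl⟩ := mem_image.mp hd'
    exact h ((dvd_mul_right p e).trans (Nat.dvd_of_mem_divisors hd))
  rw [moebiusProd, h1, prod_union h2, prod_image
    (fun a _ b _ hab => Nat.eq_of_mul_eq_mul_left hp.pos hab), div_eq_mul_inv, moebiusProd,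
    moebiusProd, ← prod_inv_distrib]
  congr 1
  refine prod_congr rfl fun d hd => ?_
  have hpd : Nat.Coprime p d := hco.coprime_dvd_right (Nat.dvd_of_mem_divisors hd)
  rw [ArithmeticFunction.isMultiplicative_moebius.map_mul_of_coprime hpd,
    ArithmeticFunction.moebius_apply_prime hp, pow_mul, neg_one_mul, zpow_neg]

/-- Pairing the residues `a` and `M - a` coprime to `M`. -/
lemma prod_coprime_eq_prod_pairs {R : Type*} [CommMonoid R] {M : ℕ} (hM : 2 < M) (F : ℕ → R) :
    ∏ n ∈ Ico 1 (1 + M) with M.Coprime n, F n =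
      ∏ n ∈ Ico 1 (1 + M) with M.Coprime n ∧ 2 * n < M, F n * F (M - n) := by
  rw [← prod_filter_mul_prod_filter_not _ (fun n => 2 * n < M), filter_filter, filter_filter,
    prod_mul_distrib]
  congr 1
  have hne : ∀ n, M.Coprime n → 2 * n ≠ M := by
    rintro n hn rfl
    have := (Nat.coprime_mul_iff_left.mp hn).2
    rw [Nat.coprime_self] at this
    omega
  have hM' : ¬ M.Coprime M := by
    rw [Nat.coprime_self]
    omega
  refine prod_nbij' (fun n => M - n) (fun n => M - n) ?_ ?_ ?_ ?_ ?_
  · simp only [mem_filter, mem_Ico]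
    rintro n ⟨⟨h1, h2⟩, h3, h4⟩
    have h5 := hne n h3
    have h6 : n ≠ M := by
      rintro rfl
      exact hM' h3
    exact ⟨by omega, (Nat.coprime_self_sub_right (by omega)).mpr h3, by omega⟩
  · simp only [mem_filter, mem_Ico]
    rintro n ⟨⟨h1, h2⟩, h3, h4⟩
    exact ⟨by omega, (Nat.coprime_self_sub_right (by omega)).mpr h3, by omega⟩
  · simp only [mem_filter, mem_Ico]
    rintro n ⟨⟨h1, h2⟩, -⟩
    omega
  · simp only [mem_filter, mem_Ico]
    rintro n ⟨⟨h1, h2⟩, -⟩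
    omega
  · simp only [mem_filter, mem_Ico]
    rintro n ⟨⟨h1, h2⟩, -⟩
    congr 1
    omega

lemma totient_eq_two_mul_card {M : ℕ} (hM : 2 < M) :
    M.totient = 2 * #{n ∈ Ico 1 (1 + M) | M.Coprime n ∧ 2 * n < M} := by
  have h := prod_coprime_eq_prod_pairs hM (fun _ => 2)
  rw [prod_const, prod_const, add_comm 1 M, add_comm M 1, Nat.filter_coprime_Ico_eq_totient,
    ← pow_two, ← pow_mul] at h
  exact Nat.pow_right_injective le_rfl h

/-- The eta quotient of Saito's conjecture, without its power of `q`. -/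
noncomputable def saitoSeries (N : ℕ) (q : ℂ) : ℂ :=
  Eprod (q ^ N) ^ N.totient / moebiusProd N q

namespace NonnegSeries

lemma saitoSeries_mul_of_dvd {p M : ℕ} (hp : p.Prime) (hM : M ≠ 0) (h : p ∣ M)
    (hs : NonnegSeries (saitoSeries M)) : NonnegSeries (saitoSeries (p * M)) := by
  refine (hs.mul (((core hp.ne_zero).comp_pow hM).pow M.totient)).congr fun q _ hq => ?_
  have h1 := Eprod_ne_zero (norm_pow_lt_one hq hM)
  rw [saitoSeries, saitoSeries, moebiusProd_mul_of_dvd hp hM h,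
    Nat.totient_mul_of_prime_of_dvd hp h, div_pow, ← pow_mul, ← pow_mul, mul_comm M p]
  field_simp

lemma saitoSeries_prime {p : ℕ} (hp : p.Prime) : NonnegSeries (saitoSeries p) := by
  refine (core hp.ne_zero).congr fun q hq0 hq => ?_
  have h1 := Eprod_ne_zero (norm_pow_lt_one hq hp.ne_zero)
  rw [saitoSeries, moebiusProd, hp.prod_divisors, ArithmeticFunction.moebius_apply_prime hp,
    Nat.totient_prime hp]
  obtain ⟨k, rfl⟩ := Nat.exists_eq_succ_of_ne_zero hp.ne_zero
  simp only [Nat.succ_eq_add_one, Nat.add_sub_cancel, ArithmeticFunction.moebius_apply_one,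
    zpow_one, pow_one, zpow_neg, pow_succ (Eprod _)] at h1 ⊢
  field_simp

lemma saitoSeries_mul_of_not_dvd {p M : ℕ} (hp : p.Prime) (hM : 2 < M) (h : ¬ p ∣ M) :
    NonnegSeries (saitoSeries (p * M)) := by
  have hM0 : M ≠ 0 := by omega
  refine (NonnegSeries.prod {n ∈ Ico 1 (1 + M) | M.Coprime n ∧ 2 * n < M} fun a ha =>
    qPoch_ratio hp.ne_zero (a := a) (M := M) ?_ ?_).congr fun q _ hq => ?_
  · simp only [mem_filter, mem_Ico] at ha
    omega
  · simp only [mem_filter, mem_Ico] at ha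
    omega
  · have hqp := norm_pow_lt_one hq hp.ne_zero
    have h1 := moebiusProd_ne_zero hq (M := M)
    have h2 := moebiusProd_ne_zero hqp (M := M)
    have h3 : Eprod (q ^ (M * p)) ^ (M * p).totient =
        ∏ n ∈ Ico 1 (1 + M) with M.Coprime n ∧ 2 * n < M,
          Eprod (q ^ (M * p)) ^ (2 * (p - 1)) := by
      rw [prod_const, ← pow_mul, mul_comm M p, Nat.totient_mul_of_prime_of_not_dvd hp h,
        totient_eq_two_mul_card hM]
      congr 1
      ring
    rw [saitoSeries, moebiusProd_mul_of_not_dvd hp hM0 h, div_div_eq_mul_div,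
      prod_div_distrib, prod_mul_distrib, mul_comm p M, h3,
      moebiusProd_eq_prod_coprime hq hM0, moebiusProd_eq_prod_coprime hqp hM0,
      prod_coprime_eq_prod_pairs hM, prod_coprime_eq_prod_pairs hM]
    simp only [← pow_mul, mul_comm p]

theorem saitoSeries {N : ℕ} (hN : 0 < N) : NonnegSeries (saitoSeries N) := by
  induction N using Nat.strong_induction_on with
  | _ N ih =>
    rcases eq_or_ne N 1 with rfl | hN1
    · refine NonnegSeries.one.congr fun q _ hq => ?_
      simp [_root_.saitoSeries, moebiusProd, Eprod_ne_zero hq]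
    have hp := Nat.minFac_prime hN1
    obtain ⟨M, hM⟩ := Nat.minFac_dvd N
    have hM0 : M ≠ 0 := by
      rintro rfl
      omega
    by_cases h : N.minFac ∣ M
    · rw [hM]
      refine saitoSeries_mul_of_dvd hp hM0 h (ih M ?_ (Nat.pos_of_ne_zero hM0))
      conv_rhs => rw [hM]
      exact lt_mul_of_one_lt_left (Nat.pos_of_ne_zero hM0) hp.one_lt
    rcases eq_or_ne M 1 with rfl | hM1
    · rw [hM, mul_one]
      exact saitoSeries_prime hp
    have hM2 : M ≠ 2 := by
      rintro rfl
      have h1 := Nat.minFac_le_of_dvd le_rfl (Dvd.intro_left _ hM.symm)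
      exact h (by rw [le_antisymm h1 hp.two_le])
    rw [hM]
    exact saitoSeries_mul_of_not_dvd hp (by omega) h

end NonnegSeries

lemma tendsto_saitoSeries {N : ℕ} (hN : N ≠ 0) : Tendsto (saitoSeries N) (𝓝 0) (𝓝 1) := by
  have h1 : ∀ {d : ℕ}, d ≠ 0 → Tendsto (fun q : ℂ => Eprod (q ^ d)) (𝓝 0) (𝓝 1) := fun {d} hd =>
    tendsto_Eprod_nhds_zero.comp (by
      simpa [hd] using (continuous_pow (M := ℂ) d).tendsto 0)
  have h2 : Tendsto (moebiusProd N) (𝓝 0) (𝓝 (∏ d ∈ N.divisors, 1)) :=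
    tendsto_finsetProd _ fun d hd => by
      simpa using (h1 (Nat.pos_of_mem_divisors hd).ne').zpow₀ (ArithmeticFunction.moebius d)
        (Or.inl one_ne_zero)
  have h3 := ((h1 hN).pow N.totient).div h2 (by simp)
  simp only [one_pow, prod_const_one, div_one] at h3
  exact h3

lemma Eprod_zero : Eprod 0 = 1 := by
  simp [Eprod]

lemma saitoSeries_zero {N : ℕ} (hN : N ≠ 0) : saitoSeries N 0 = 1 := by
  have h : moebiusProd N 0 = 1 := prod_eq_one fun d hd => by
    rw [zero_pow (Nat.pos_of_mem_divisors hd).ne', Eprod_zero, one_zpow]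
  rw [saitoSeries, h, zero_pow hN, Eprod_zero, one_pow, div_one]

lemma tendsto_tsum_mul_pow_zero {c : ℕ → ℂ} {r : ℝ} (hr : 0 < r)
    (h : Summable fun n => ‖c n * (r : ℂ) ^ n‖) :
    Tendsto (fun q : ℂ => ∑' n, c n * q ^ n) (𝓝 0) (𝓝 (c 0)) := by
  have h1 := tendsto_tsum_of_dominated_convergence (𝓕 := 𝓝 (0 : ℂ))
    (f := fun q n => c n * q ^ n) (g := fun n => c n * 0 ^ n) h
    (fun n => (Continuous.tendsto (by fun_prop) 0)) ?_
  · rwa [tsum_eq_single 0 (fun n hn => by simp [hn]), pow_zero, mul_one] at h1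
  · filter_upwards [Metric.ball_mem_nhds (0 : ℂ) hr] with q hq n
    rw [norm_mul, norm_mul, norm_pow, norm_pow, Complex.norm_real, Real.norm_of_nonneg hr.le]
    gcongr
    exact (mem_ball_zero_iff.mp hq).le

/-- K. Saito's conjecture: for every positive integer `N`, the series
`S̃_N(q) = E(q^N)^{φ(N)} / ∏_{d ∣ N} E(q^d)^{μ(d)}`
has nonnegative coefficients. -/
theorem saito_conjecture (N : ℕ) (hN : 0 < N) :
    ∃ c : ℕ → ℝ, (∀ n, 0 ≤ c n) ∧
      ∀ q : ℂ, ‖q‖ < 1 →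
        Eprod (q ^ N) ^ N.totient /
            ∏ d ∈ N.divisors, Eprod (q ^ d) ^ (ArithmeticFunction.moebius d) =
          ∑' n : ℕ, (c n : ℂ) * q ^ n := by
  obtain ⟨c, hc, hs⟩ := NonnegSeries.saitoSeries hN
  refine ⟨c, hc, fun q hq => ?_⟩
  change saitoSeries N q = _
  rcases eq_or_ne q 0 with rfl | hq0
  · have h1 := tendsto_tsum_mul_pow_zero (c := fun n => (c n : ℂ)) (r := 1 / 2) (by norm_num)
      (hs _ (by norm_num) (by norm_num)).summable.norm
    have h2 : ∀ᶠ q : ℂ in 𝓝[≠] 0, ∑' n, (c n : ℂ) * q ^ n = saitoSeries N q := by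
      filter_upwards [self_mem_nhdsWithin,
        nhdsWithin_le_nhds (Metric.ball_mem_nhds (0 : ℂ) one_pos)] with q hq0 hq
      exact (hs q hq0 (mem_ball_zero_iff.mp hq)).tsum_eq
    have h3 := tendsto_nhds_unique ((h1.mono_left nhdsWithin_le_nhds).congr' h2)
      ((tendsto_saitoSeries hN.ne').mono_left nhdsWithin_le_nhds)
    rw [saitoSeries_zero hN.ne', tsum_eq_single 0 (fun n hn => by simp [hn]), pow_zero, mul_one]
    exact h3.symm
  · exact (hs q hq0 hq).tsum_eq.symm
end

section
/- For |q| < 1 and |t| < 1 and any a, the series (at;q)_∞ / ((a;q)_∞ (t;q)_∞) equals ∑_{n=0}^∞ t^n / ((a q^n; q)_∞ (q;q)_n). In particular, as a formal power series in q, ∏_{n≥0} (1 - q^{Mn+a+b}) / ((1 - q^{Mn+a})(1 - q^{Mn+b})) has nonnegative coefficients for all positive integers a, b, M. -/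
/-- `(x;q)_∞ = ∏_{j ≥ 0} (1 - x qʲ)`. -/
noncomputable def poch (x q : ℂ) : ℂ := ∏' j : ℕ, (1 - x * q ^ j)

/-- `(q;q)_n = ∏_{j=1}^n (1 - qʲ)`. -/
noncomputable def pochFin (q : ℂ) (n : ℕ) : ℂ := ∏ j ∈ Finset.range n, (1 - q ^ (j + 1))

lemma summable_norm_neg_mul_pow (x : ℂ) {q : ℂ} (hq : ‖q‖ < 1) :
    Summable fun j : ℕ => ‖-(x * q ^ j)‖ := by
  simpa using (summable_geometric_of_lt_one (norm_nonneg q) hq).mul_left ‖x‖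

lemma multipliable_poch (x : ℂ) {q : ℂ} (hq : ‖q‖ < 1) :
    Multipliable fun j : ℕ => 1 - x * q ^ j := by
  simpa [sub_eq_add_neg] using multipliable_one_add_of_summable (summable_norm_neg_mul_pow x hq)

lemma one_sub_ne_zero_of_norm_lt_one {z : ℂ} (hz : ‖z‖ < 1) : 1 - z ≠ 0 := by
  intro h
  simp [← sub_eq_zero.mp h] at hz

lemma norm_mul_pow_lt_one {x q : ℂ} (hx : ‖x‖ < 1) (hq : ‖q‖ < 1) (j : ℕ) :
    ‖x * q ^ j‖ < 1 := by
  rw [norm_mul, norm_pow]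
  exact (mul_le_of_le_one_right (norm_nonneg x) (pow_le_one₀ (norm_nonneg q) hq.le)).trans_lt hx

lemma poch_ne_zero {x q : ℂ} (hx : ‖x‖ < 1) (hq : ‖q‖ < 1) : poch x q ≠ 0 := by
  have := tprod_one_add_ne_zero_of_summable (f := fun j : ℕ => -(x * q ^ j))
    (fun j => by
      simpa [sub_eq_add_neg] using one_sub_ne_zero_of_norm_lt_one (norm_mul_pow_lt_one hx hq j))
    (summable_norm_neg_mul_pow x hq)
  simpa [poch, sub_eq_add_neg] using this

lemma pochFin_ne_zero {q : ℂ} (hq : ‖q‖ < 1) (n : ℕ) : pochFin q n ≠ 0 := by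
  refine Finset.prod_ne_zero_iff.mpr fun j _ => ?_
  simpa [pow_succ'] using one_sub_ne_zero_of_norm_lt_one (norm_mul_pow_lt_one hq hq j)

lemma prod_mul_poch (x : ℂ) {q : ℂ} (hq : ‖q‖ < 1) (n : ℕ) :
    (∏ j ∈ Finset.range n, (1 - x * q ^ j)) * poch (x * q ^ n) q = poch x q := by
  have h := multipliable_poch (x * q ^ n) hq
  have e : (fun j : ℕ => 1 - x * q ^ n * q ^ j) = fun j => 1 - x * q ^ (j + n) := by
    ext j; ring
  rw [e] at h
  rw [poch, e, poch]
  exact Multipliable.prod_mul_tprod_nat_mul' (f := fun j : ℕ => 1 - x * q ^ j) h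

/-- The coefficient `(a;q)_n / (q;q)_n` of the `q`-binomial series. -/
noncomputable def qBinomCoeff (a q : ℂ) (n : ℕ) : ℂ :=
  (∏ j ∈ Finset.range n, (1 - a * q ^ j)) / pochFin q n

lemma qBinomCoeff_succ (a : ℂ) {q : ℂ} (hq : ‖q‖ < 1) (n : ℕ) :
    qBinomCoeff a q (n + 1) * (1 - q ^ (n + 1)) = qBinomCoeff a q n * (1 - a * q ^ n) := by
  have h1 := pochFin_ne_zero hq n
  have h2 := pochFin_ne_zero hq (n + 1)
  have e : pochFin q (n + 1) = pochFin q n * (1 - q ^ (n + 1)) := Finset.prod_range_succ _ _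
  rw [e] at h2
  have h3 := right_ne_zero_of_mul h2
  simp only [qBinomCoeff, e, Finset.prod_range_succ]
  field_simp

open Filter Topology in
lemma exists_norm_qBinomCoeff_le (a : ℂ) {q : ℂ} (hq : ‖q‖ < 1) :
    ∃ C, ∀ n, ‖qBinomCoeff a q n‖ ≤ C := by
  have hden : Tendsto (fun n => pochFin q n) atTop (𝓝 (poch q q)) := by
    simpa only [pochFin, poch, pow_succ'] using (multipliable_poch q hq).hasProd.tendsto_prod_nat
  have h : Tendsto (qBinomCoeff a q) atTop (𝓝 (poch a q / poch q q)) :=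
    (multipliable_poch a hq).hasProd.tendsto_prod_nat.div hden (poch_ne_zero hq hq)
  obtain ⟨C, hC⟩ := (Metric.isBounded_range_of_tendsto _ h).exists_norm_le
  exact ⟨C, fun n => hC _ ⟨n, rfl⟩⟩

lemma summable_qBinomCoeff (a : ℂ) {t q : ℂ} (hq : ‖q‖ < 1) (ht : ‖t‖ < 1) :
    Summable fun n => qBinomCoeff a q n * t ^ n := by
  obtain ⟨C, hC⟩ := exists_norm_qBinomCoeff_le a hq
  refine Summable.of_norm_bounded ((summable_geometric_of_lt_one (norm_nonneg t) ht).mul_left C)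
    fun n => ?_
  rw [norm_mul, norm_pow]
  exact mul_le_mul_of_nonneg_right (hC n) (by positivity)

lemma one_sub_mul_tsum_qBinomCoeff (a : ℂ) {t q : ℂ} (hq : ‖q‖ < 1) (ht : ‖t‖ < 1) :
    (1 - t) * ∑' n, qBinomCoeff a q n * t ^ n =
      (1 - a * t) * ∑' n, qBinomCoeff a q n * (t * q) ^ n := by
  have htq : ‖t * q‖ < 1 := by simpa using norm_mul_pow_lt_one ht hq 1
  have s1 := summable_qBinomCoeff a hq ht
  have s2 := summable_qBinomCoeff a hq htq
  have h : ∑' n, qBinomCoeff a q n * t ^ n - ∑' n, qBinomCoeff a q n * (t * q) ^ n =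
      t * ∑' n, qBinomCoeff a q n * t ^ n - a * t * ∑' n, qBinomCoeff a q n * (t * q) ^ n := by
    rw [← s1.tsum_sub s2, (s1.sub s2).tsum_eq_zero_add, ← tsum_mul_left, ← tsum_mul_left,
      ← (s1.mul_left t).tsum_sub (s2.mul_left (a * t))]
    simp only [pow_zero, sub_self, zero_add]
    refine tsum_congr fun n => ?_
    linear_combination t ^ (n + 1) * qBinomCoeff_succ a hq n
  linear_combination h

open Filter Topology in
lemma tendsto_tsum_qBinomCoeff (a : ℂ) {t q : ℂ} (hq : ‖q‖ < 1) (ht : ‖t‖ < 1) :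
    Tendsto (fun N : ℕ => ∑' n, qBinomCoeff a q n * (t * q ^ N) ^ n) atTop (𝓝 1) := by
  obtain ⟨C, hC⟩ := exists_norm_qBinomCoeff_le a hq
  have h0 : Tendsto (fun N : ℕ => t * q ^ N) atTop (𝓝 0) := by
    simpa using (tendsto_pow_atTop_nhds_zero_of_norm_lt_one hq).const_mul t
  have h1 : ∑' n, qBinomCoeff a q n * (0 : ℂ) ^ n = 1 := by
    rw [tsum_eq_single 0 fun n hn => by simp [hn]]
    simp [qBinomCoeff, pochFin]
  rw [← h1]
  refine tendsto_tsum_of_dominated_convergence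
    ((summable_geometric_of_lt_one (norm_nonneg t) ht).mul_left C)
    (fun n => (h0.pow n).const_mul _) (Eventually.of_forall fun N n => ?_)
  rw [norm_mul, norm_pow]
  refine mul_le_mul (hC n) (pow_le_pow_left₀ (norm_nonneg _) ?_ n) (by positivity)
    ((norm_nonneg _).trans (hC 0))
  rw [norm_mul, norm_pow]
  exact mul_le_of_le_one_right (norm_nonneg t) (pow_le_one₀ (norm_nonneg q) hq.le)

lemma prod_mul_tsum_qBinomCoeff (a : ℂ) {t q : ℂ} (hq : ‖q‖ < 1) (ht : ‖t‖ < 1) (N : ℕ) :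
    (∏ j ∈ Finset.range N, (1 - t * q ^ j)) * ∑' n, qBinomCoeff a q n * t ^ n =
      (∏ j ∈ Finset.range N, (1 - a * t * q ^ j)) *
        ∑' n, qBinomCoeff a q n * (t * q ^ N) ^ n := by
  induction N with
  | zero => simp
  | succ N ih =>
    have h := one_sub_mul_tsum_qBinomCoeff a hq (norm_mul_pow_lt_one ht hq N)
    rw [Finset.prod_range_succ, Finset.prod_range_succ, pow_succ, ← mul_assoc t]
    linear_combination (1 - t * q ^ N) * ih + (∏ j ∈ Finset.range N, (1 - a * t * q ^ j)) * h

/-- The `q`-binomial theorem. -/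
theorem hasSum_qBinomCoeff (a : ℂ) {t q : ℂ} (hq : ‖q‖ < 1) (ht : ‖t‖ < 1) :
    HasSum (fun n => qBinomCoeff a q n * t ^ n) (poch (a * t) q / poch t q) := by
  rw [(summable_qBinomCoeff a hq ht).hasSum_iff, eq_div_iff (poch_ne_zero ht hq), mul_comm]
  have h1 := ((multipliable_poch t hq).hasProd.tendsto_prod_nat).mul_const
    (∑' n, qBinomCoeff a q n * t ^ n)
  have h2 := ((multipliable_poch (a * t) hq).hasProd.tendsto_prod_nat).mul
    (tendsto_tsum_qBinomCoeff a hq ht)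
  simp only [prod_mul_tsum_qBinomCoeff a hq ht] at h1
  simpa [poch] using tendsto_nhds_unique h1 h2

theorem hasSum_poch_div {a t q : ℂ} (hq : ‖q‖ < 1) (ht : ‖t‖ < 1) (ha : poch a q ≠ 0) :
    HasSum (fun n : ℕ => t ^ n / (poch (a * q ^ n) q * pochFin q n))
      (poch (a * t) q / (poch a q * poch t q)) := by
  rw [mul_comm (poch a q), ← div_div]
  refine HasSum.congr_fun ((hasSum_qBinomCoeff a hq ht).div_const (poch a q)) fun n => ?_
  have h := prod_mul_poch a hq n
  rw [← h] at ha ⊢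
  have h1 := left_ne_zero_of_mul ha
  have h2 := right_ne_zero_of_mul ha
  have h3 := pochFin_ne_zero hq n
  rw [qBinomCoeff]
  field_simp

/-- On the open unit disc, `f` is the sum of a power series with nonnegative coefficients. -/
def HasNonnegPowerSeries (f : ℂ → ℂ) : Prop :=
  ∃ c : ℕ → ℝ, (∀ n, 0 ≤ c n) ∧ ∀ q : ℂ, ‖q‖ < 1 → HasSum (fun n => (c n : ℂ) * q ^ n) (f q)

namespace HasNonnegPowerSeries

lemma pow (k : ℕ) : HasNonnegPowerSeries fun q => q ^ k := by
  refine ⟨fun n => if n = k then 1 else 0, fun n => by positivity, fun q _ => ?_⟩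
  convert hasSum_ite_eq k (q ^ k) using 2 with n
  split_ifs with h <;> simp [h]

lemma mul {f g : ℂ → ℂ} (hf : HasNonnegPowerSeries f) (hg : HasNonnegPowerSeries g) :
    HasNonnegPowerSeries fun q => f q * g q := by
  obtain ⟨c, hc, hcf⟩ := hf
  obtain ⟨d, hd, hdg⟩ := hg
  refine ⟨fun n => ∑ k ∈ Finset.range (n + 1), c k * d (n - k),
    fun n => Finset.sum_nonneg fun k _ => mul_nonneg (hc _) (hd _), fun q hq => ?_⟩
  have h := hasSum_sum_range_mul_of_summable_norm (hcf q hq).summable.norm (hdg q hq).summable.norm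
  rw [(hcf q hq).tsum_eq, (hdg q hq).tsum_eq] at h
  refine HasSum.congr_fun h fun n => ?_
  push_cast
  rw [Finset.sum_mul]
  refine Finset.sum_congr rfl fun k hk => ?_
  rw [← pow_mul_pow_sub q (Finset.mem_range_succ_iff.mp hk)]
  ring

lemma of_hasSum {f : ℕ → ℂ → ℂ} {g : ℂ → ℂ} (hf : ∀ k, HasNonnegPowerSeries (f k))
    (hg : ∀ q, ‖q‖ < 1 → HasSum (fun k => f k q) (g q)) : HasNonnegPowerSeries g := by
  choose c hc hcf using hf
  refine ⟨fun n => ∑' k, c k n, fun n => tsum_nonneg fun k => hc k n, fun q hq => ?_⟩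
  have hr : ‖((‖q‖ : ℝ) : ℂ)‖ < 1 := by simpa using hq
  have hR (k : ℕ) : HasSum (fun n => c k n * ‖q‖ ^ n) (f k (‖q‖ : ℝ)).re := by
    convert Complex.hasSum_re (hcf k _ hr) using 2 with n
    norm_cast
  have hS : Summable fun p : ℕ × ℕ => (c p.1 p.2 : ℂ) * q ^ p.2 := by
    refine Summable.of_norm ?_
    refine ((summable_prod_of_nonneg (f := fun p : ℕ × ℕ => c p.1 p.2 * ‖q‖ ^ p.2)
      fun p => mul_nonneg (hc _ _) (by positivity)).mpr
      ⟨fun k => (hR k).summable, ?_⟩).congr fun p => ?_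
    · simp only [fun k => (hR k).tsum_eq]
      exact (Complex.hasSum_re (hg _ hr)).summable
    · rw [norm_mul, norm_pow, Complex.norm_real, Real.norm_of_nonneg (hc _ _)]
  have hsum : HasSum (fun p : ℕ × ℕ => (c p.1 p.2 : ℂ) * q ^ p.2) (g q) := by
    rw [← (hS.hasSum.prod_fiberwise fun k => hcf k q hq).unique (hg q hq)]
    exact hS.hasSum
  have hswap := (Equiv.prodComm ℕ ℕ).hasSum_iff.mpr hsum
  refine hswap.prod_fiberwise fun n => ?_
  rw [Complex.ofReal_tsum, ← tsum_mul_right]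
  exact (hswap.summable.prod_factor n).hasSum

lemma inv_one_sub_pow {k : ℕ} (hk : k ≠ 0) : HasNonnegPowerSeries fun q => (1 - q ^ k)⁻¹ := by
  refine of_hasSum (f := fun n q => q ^ (k * n)) (fun n => pow _) fun q hq => ?_
  simp only [pow_mul]
  refine hasSum_geometric_of_norm_lt_one ?_
  rw [norm_pow]
  exact pow_lt_one₀ (norm_nonneg q) hq hk

lemma inv_pochFin {M : ℕ} (hM : M ≠ 0) (n : ℕ) :
    HasNonnegPowerSeries fun q => (pochFin (q ^ M) n)⁻¹ := by
  induction n with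
  | zero => simpa [pochFin] using pow 0
  | succ n ih =>
    simpa [pochFin, Finset.prod_range_succ, ← pow_mul, mul_comm] using
      ih.mul (inv_one_sub_pow (k := M * (n + 1)) (by positivity))

lemma inv_poch {k M : ℕ} (hk : k ≠ 0) (hM : M ≠ 0) :
    HasNonnegPowerSeries fun q => (poch (q ^ k) (q ^ M))⁻¹ := by
  refine of_hasSum (fun n => (pow (k * n)).mul (inv_pochFin hM n)) fun q hq => ?_
  have hlt {j : ℕ} (hj : j ≠ 0) : ‖q ^ j‖ < 1 := by
    rw [norm_pow]
    exact pow_lt_one₀ (norm_nonneg q) hq hj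
  simpa [poch, pow_mul, div_eq_mul_inv] using
    hasSum_poch_div (a := 0) (hlt hM) (hlt hk) (by simp [poch])

end HasNonnegPowerSeries

lemma hasNonnegPowerSeries_poch_div {a b M : ℕ} (ha : a ≠ 0) (hb : b ≠ 0) (hM : M ≠ 0) :
    HasNonnegPowerSeries fun q =>
      poch (q ^ a * q ^ b) (q ^ M) / (poch (q ^ a) (q ^ M) * poch (q ^ b) (q ^ M)) := by
  refine HasNonnegPowerSeries.of_hasSum (fun n => (HasNonnegPowerSeries.pow (b * n)).mul
    ((HasNonnegPowerSeries.inv_poch (k := a + M * n) (by positivity) hM).mul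
      (HasNonnegPowerSeries.inv_pochFin hM n))) fun q hq => ?_
  have hlt {j : ℕ} (hj : j ≠ 0) : ‖q ^ j‖ < 1 := by
    rw [norm_pow]
    exact pow_lt_one₀ (norm_nonneg q) hq hj
  convert hasSum_poch_div (hlt hM) (hlt hb) (poch_ne_zero (hlt ha) (hlt hM)) using 2 with n
  rw [pow_mul, pow_add, pow_mul, div_eq_mul_inv, mul_inv]

/-- The `q`-binomial theorem consequence: for `|q| < 1`, `|t| < 1` and any `a`
(avoiding the zeros of `(a;q)_∞`),
`(at;q)_∞ / ((a;q)_∞ (t;q)_∞) = ∑_{n ≥ 0} tⁿ / ((aqⁿ;q)_∞ (q;q)_n)`;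
in particular `∏_{n ≥ 0} (1-q^{Mn+a+b}) / ((1-q^{Mn+a})(1-q^{Mn+b}))` has
nonnegative coefficients for all positive integers `a, b, M`. -/
theorem q_binomial_nonneg :
    (∀ a t q : ℂ, ‖q‖ < 1 → ‖t‖ < 1 → poch a q ≠ 0 →
      poch (a * t) q / (poch a q * poch t q) =
        ∑' n : ℕ, t ^ n / (poch (a * q ^ n) q * pochFin q n)) ∧
    ∀ a b M : ℕ, 0 < a → 0 < b → 0 < M →
      ∃ c : ℕ → ℝ, (∀ n, 0 ≤ c n) ∧
        ∀ q : ℂ, ‖q‖ < 1 →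
          (∏' n : ℕ, (1 - q ^ (M * n + a + b)) /
              ((1 - q ^ (M * n + a)) * (1 - q ^ (M * n + b)))) =
            ∑' n : ℕ, (c n : ℂ) * q ^ n := by
  refine ⟨fun a t q hq ht ha => (hasSum_poch_div hq ht ha).tsum_eq.symm, fun a b M ha hb hM => ?_⟩
  obtain ⟨c, hc, hcq⟩ := hasNonnegPowerSeries_poch_div ha.ne' hb.ne' hM.ne'
  refine ⟨c, hc, fun q hq => ?_⟩
  have hlt {j : ℕ} (hj : 0 < j) : ‖q ^ j‖ < 1 := by
    rw [norm_pow]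
    exact pow_lt_one₀ (norm_nonneg q) hq hj.ne'
  have hden := (multipliable_poch (q ^ a) (hlt hM)).hasProd.mul
    (multipliable_poch (q ^ b) (hlt hM)).hasProd
  have h := (multipliable_poch (q ^ a * q ^ b) (hlt hM)).hasProd.div₀ hden
    (mul_ne_zero (poch_ne_zero (hlt ha) (hlt hM)) (poch_ne_zero (hlt hb) (hlt hM)))
  rw [(hcq q hq).tsum_eq]
  refine Eq.trans (tprod_congr fun n => ?_) h.tprod_eq
  congr 1 <;> ring
end
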